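/- arXiv:1901.10333 — 6 statements merged into one kernel-verified Lean document; each statement's English description precedes it below -/
import Mathlib

section
/- Let T > 0 and a, b ∈ (0,1]. Then there exists a constant C > 0, depending only on a, b and T but not on N, such that for every integer N ≥ 1, every n ∈ {0,1,...,N}, and every t ∈ [t_n, t_{n+1}), one has ∫₀^{t_n} |(t−s)^{a−b} − (t_n−s)^{a−b}| ds ≤ C · N^{max(−1, −1−a+b)}. -/
theorem intervalIntegrable_sub_rpow {c : ℝ} (hc : -1 < c) (t u v : ℝ) :
    IntervalIntegrable (fun s : ℝ => (t - s) ^ c) MeasureTheory.volume u v := by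
  simpa using
    (intervalIntegral.intervalIntegrable_rpow' (a := t - u) (b := t - v) hc).comp_sub_left t

theorem integral_sub_rpow {c : ℝ} (hc : -1 < c) (t τ : ℝ) :
    ∫ s in (0:ℝ)..τ, (t - s) ^ c = (t ^ (c + 1) - (t - τ) ^ (c + 1)) / (c + 1) := by
  rw [intervalIntegral.integral_comp_sub_left (fun x : ℝ => x ^ c) t,
    integral_rpow (Or.inl hc), sub_zero]

/-- The difference of two shifted kernels has a constant sign `σ`, so that the integral of its
absolute value is explicit. -/
theorem integral_abs_sub_rpow {c τ t : ℝ} (hc : -1 < c) (hτ : 0 ≤ τ) (σ : ℝ)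
    (hσ : ∀ s ∈ Set.Ioo 0 τ,
      |(t - s) ^ c - (τ - s) ^ c| = σ * ((t - s) ^ c - (τ - s) ^ c)) :
    ∫ s in (0:ℝ)..τ, |(t - s) ^ c - (τ - s) ^ c| =
      σ * ((t ^ (c + 1) - (t - τ) ^ (c + 1) - τ ^ (c + 1)) / (c + 1)) := by
  have hcongr : ∫ s in (0:ℝ)..τ, |(t - s) ^ c - (τ - s) ^ c| =
      ∫ s in (0:ℝ)..τ, σ * ((t - s) ^ c - (τ - s) ^ c) := by
    simp only [intervalIntegral.integral_of_le hτ, MeasureTheory.integral_Ioc_eq_integral_Ioo]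
    exact MeasureTheory.setIntegral_congr_fun measurableSet_Ioo hσ
  rw [hcongr, intervalIntegral.integral_const_mul,
    intervalIntegral.integral_sub (intervalIntegrable_sub_rpow hc t 0 τ)
      (intervalIntegrable_sub_rpow hc τ 0 τ), integral_sub_rpow hc, integral_sub_rpow hc,
    sub_self, Real.zero_rpow (by linarith : c + 1 ≠ 0)]
  ring

theorem rpow_sub_rpow_le {c τ t : ℝ} (hc : 0 ≤ c) (hτ : 0 ≤ τ) (h : τ ≤ t) :
    t ^ (c + 1) - τ ^ (c + 1) ≤ (c + 1) * (t ^ c * (t - τ)) := by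
  rcases (hτ.trans h).eq_or_lt with rfl | ht
  · obtain rfl : τ = 0 := le_antisymm h hτ
    simp
  have hdiv : 1 + (τ / t - 1) = τ / t := by ring
  have hnonneg : 0 ≤ τ / t := by positivity
  have hbern := one_add_mul_self_le_rpow_one_add (s := τ / t - 1) (by linarith)
    (p := c + 1) (by linarith)
  rw [hdiv, Real.div_rpow hτ ht.le, le_div_iff₀ (by positivity)] at hbern
  have hpow : t ^ (c + 1) = t ^ c * t := Real.rpow_add_one ht.ne' c
  have hexpand : (1 + (c + 1) * (τ / t - 1)) * t ^ (c + 1) =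
      t ^ (c + 1) - (c + 1) * (t ^ c * (t - τ)) := by
    rw [hpow]
    field_simp
    ring
  linarith

theorem integral_abs_sub_rpow_le_of_nonneg {c τ t : ℝ} (hc : 0 ≤ c) (hτ : 0 ≤ τ) (h : τ ≤ t) :
    ∫ s in (0:ℝ)..τ, |(t - s) ^ c - (τ - s) ^ c| ≤ t ^ c * (t - τ) := by
  rw [integral_abs_sub_rpow (by linarith) hτ 1 fun s hs => ?_, one_mul,
    div_le_iff₀ (by linarith)]
  · have := Real.rpow_nonneg (sub_nonneg.2 h) (c + 1)
    linarith [rpow_sub_rpow_le hc hτ h]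
  · rw [one_mul, abs_of_nonneg (sub_nonneg.2 _)]
    exact Real.rpow_le_rpow (by linarith [hs.2]) (by linarith) hc

theorem integral_abs_sub_rpow_le_of_nonpos {c τ t : ℝ} (hc : -1 < c) (hc' : c ≤ 0) (hτ : 0 ≤ τ)
    (h : τ ≤ t) :
    ∫ s in (0:ℝ)..τ, |(t - s) ^ c - (τ - s) ^ c| ≤ (t - τ) ^ (c + 1) / (c + 1) := by
  rw [integral_abs_sub_rpow hc hτ (-1) fun s hs => ?_, ← mul_div_assoc]
  · have := Real.rpow_le_rpow hτ h (by linarith : 0 ≤ c + 1)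
    exact div_le_div_of_nonneg_right (by linarith) (by linarith)
  · rw [neg_one_mul, abs_of_nonpos (sub_nonpos.2 _)]
    exact Real.rpow_le_rpow_of_nonpos (by linarith [hs.2]) (by linarith) hc'

/-- Lemma 3.1 of the paper: a deterministic estimate for the difference of
weakly singular kernels, with `t_k = k * (T/N)`. -/
theorem stmt_0 (T : ℝ) (hT : 0 < T) (a b : ℝ)
    (ha : a ∈ Set.Ioc (0:ℝ) 1) (hb : b ∈ Set.Ioc (0:ℝ) 1) :
    ∃ C : ℝ, 0 < C ∧ ∀ N : ℕ, 1 ≤ N → ∀ n : ℕ, n ≤ N → ∀ t : ℝ,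
      t ∈ Set.Ico ((n : ℝ) * (T / N)) (((n : ℝ) + 1) * (T / N)) →
      (∫ s in (0:ℝ)..((n : ℝ) * (T / N)),
          |(t - s) ^ (a - b) - ((n : ℝ) * (T / N) - s) ^ (a - b)|) ≤
        C * (N : ℝ) ^ (max (-1 : ℝ) (-1 - a + b)) := by
  have hc : -1 < a - b := by linarith [ha.1, hb.2]
  rcases le_total 0 (a - b) with hab | hab
  · refine ⟨(2 * T) ^ (a - b) * T, by positivity, fun N hN n hn t ht => ?_⟩
    have hN1 : (1 : ℝ) ≤ N := by exact_mod_cast hN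
    have hN0 : (0 : ℝ) < N := by linarith
    have hn' : (n : ℝ) ≤ N := by exact_mod_cast hn
    have hτ : 0 ≤ (n : ℝ) * (T / N) := by positivity
    have hstep : t - n * (T / N) ≤ T / N := by linarith [ht.2]
    have ht2 : t ≤ 2 * T := by
      calc t ≤ ((n : ℝ) + 1) * (T / N) := ht.2.le
        _ ≤ (2 * N) * (T / N) := by gcongr; linarith
        _ = 2 * T := by field_simp
    rw [max_eq_left (by linarith), Real.rpow_neg_one, mul_assoc, ← div_eq_mul_inv]
    refine (integral_abs_sub_rpow_le_of_nonneg hab hτ ht.1).trans ?_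
    exact mul_le_mul (Real.rpow_le_rpow (hτ.trans ht.1) ht2 hab) hstep
      (sub_nonneg.2 ht.1) (by positivity)
  · have hp : 0 < a - b + 1 := by linarith
    refine ⟨T ^ (a - b + 1) / (a - b + 1), by positivity, fun N hN n hn t ht => ?_⟩
    have hN0 : (0 : ℝ) < N := by exact_mod_cast hN
    have hτ : 0 ≤ (n : ℝ) * (T / N) := by positivity
    have hstep : t - n * (T / N) ≤ T / N := by linarith [ht.2]
    refine (integral_abs_sub_rpow_le_of_nonpos hc hab hτ ht.1).trans ?_
    rw [max_eq_right (by linarith), show -1 - a + b = -(a - b + 1) by ring,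
      Real.rpow_neg hN0.le, div_mul_eq_mul_div, ← div_eq_mul_inv, ← Real.div_rpow hT.le hN0.le]
    exact div_le_div_of_nonneg_right
      (Real.rpow_le_rpow (sub_nonneg.2 ht.1) hstep hp.le) hp.le
end

section
/- Let T > 0, a, b ∈ (0,1] with a − b ∈ (0,1). Then for every integer N ≥ 1, every n ∈ {1,...,N}, and every t ∈ [t_n, t_{n+1}), one has ∫₀^{t_n} ((t−s)^{a−b} − (t_n−s)^{a−b}) ds ≤ (T/N)^{1+a−b} · ((n+1)^{a−b} + n^{a−b} − 1). -/
/-- Shifting `u` to `t` increases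
`∫ s in 0..u, (u - s) ^ c` by at most `(t - u) * t ^ c`. -/
theorem integral_sub_rpow_sub_le {c u t : ℝ} (hc : 0 ≤ c) (hu : 0 ≤ u) (hut : u ≤ t) :
    (∫ s in (0:ℝ)..u, ((t - s) ^ c - (u - s) ^ c)) ≤ (t - u) * t ^ c := by
  have hcont : Continuous fun x : ℝ => x ^ c := Real.continuous_rpow_const hc
  have hint : ∀ p q : ℝ, IntervalIntegrable (fun x : ℝ => x ^ c) MeasureTheory.volume p q :=
    fun p q => hcont.intervalIntegrable p q
  have hint_sub : ∀ d : ℝ,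
      IntervalIntegrable (fun x : ℝ => (d - x) ^ c) MeasureTheory.volume 0 u :=
    fun d => (hcont.comp (continuous_const.sub continuous_id)).intervalIntegrable _ _
  rw [intervalIntegral.integral_sub (hint_sub t) (hint_sub u),
    intervalIntegral.integral_comp_sub_left (fun x : ℝ => x ^ c) t,
    intervalIntegral.integral_comp_sub_left (fun x : ℝ => x ^ c) u, sub_self, sub_zero, sub_zero]
  have h1 := intervalIntegral.integral_add_adjacent_intervals (hint 0 (t - u)) (hint (t - u) t)
  have h2 := intervalIntegral.integral_add_adjacent_intervals (hint 0 u) (hint u t)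
  have h3 : 0 ≤ ∫ x in (0:ℝ)..(t - u), x ^ c :=
    intervalIntegral.integral_nonneg (sub_nonneg.2 hut) fun x hx => Real.rpow_nonneg hx.1 c
  have h4 : (∫ x in u..t, x ^ c) ≤ ∫ _ in u..t, t ^ c :=
    intervalIntegral.integral_mono_on hut (hint u t) intervalIntegrable_const
      fun x hx => Real.rpow_le_rpow (hu.trans hx.1) hx.2 hc
  rw [intervalIntegral.integral_const, smul_eq_mul] at h4
  linarith

/-- The explicit intermediate bound in the proof of Lemma 3.1, case `a - b ∈ (0,1)`. -/
theorem stmt_1 (T : ℝ) (hT : 0 < T) (a b : ℝ)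
    (ha : a ∈ Set.Ioc (0:ℝ) 1) (hb : b ∈ Set.Ioc (0:ℝ) 1)
    (hab : a - b ∈ Set.Ioo (0:ℝ) 1) :
    ∀ N : ℕ, 1 ≤ N → ∀ n : ℕ, 1 ≤ n → n ≤ N → ∀ t : ℝ,
      t ∈ Set.Ico ((n : ℝ) * (T / N)) (((n : ℝ) + 1) * (T / N)) →
      (∫ s in (0:ℝ)..((n : ℝ) * (T / N)),
          ((t - s) ^ (a - b) - ((n : ℝ) * (T / N) - s) ^ (a - b))) ≤
        (T / N) ^ (1 + a - b) * (((n : ℝ) + 1) ^ (a - b) + (n : ℝ) ^ (a - b) - 1) := by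
  intro N hN n hn _ t ht
  have hh : 0 < T / N := div_pos hT (by exact_mod_cast hN)
  set h := T / (N : ℝ)
  have hn1 : (1 : ℝ) ≤ n := by exact_mod_cast hn
  have hu : 0 ≤ (n : ℝ) * h := by positivity
  have hc := hab.1.le
  calc _ ≤ (t - n * h) * t ^ (a - b) := integral_sub_rpow_sub_le hc hu ht.1
    _ ≤ h * (((n : ℝ) + 1) * h) ^ (a - b) :=
      mul_le_mul (by linarith [ht.2]) (Real.rpow_le_rpow (hu.trans ht.1) ht.2.le hc)
        (Real.rpow_nonneg (hu.trans ht.1) _) hh.le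
    _ = h ^ (1 + a - b) * ((n : ℝ) + 1) ^ (a - b) := by
      rw [Real.mul_rpow (by positivity) hh.le, add_sub_assoc, Real.rpow_add hh, Real.rpow_one]
      ring
    _ ≤ _ := by
      gcongr
      linarith [Real.one_le_rpow hn1 hc]
end

section
/- Let T > 0, a ∈ (0,1] and b ∈ (0,1/2), so that a − b ∈ (−1/2, 1). Then there exists a constant C > 0, independent of N, such that for every integer N ≥ 1, every n ∈ {0,1,...,N}, and every t ∈ [t_n, t_{n+1}), the quantity I := ∫₀^{t_n} |(t−s)^{a−b} − (t_n−s)^{a−b}|² ds satisfies: I ≤ C·N^{−2} if a − b ∈ (1/2, 1); I ≤ C·(ln N)·N^{−2} if a − b = 1/2 and N ≥ 2; and I ≤ C·N^{−1−2(a−b)} if a − b ∈ (−1/2, 1/2). -/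
/-- Mean value bound for the increment of a power with exponent in `[-1, 1]`. -/
lemma abs_rpow_add_sub_rpow_le {γ u δ : ℝ} (hγ : |γ| ≤ 1) (hu : 0 < u) (hδ : 0 ≤ δ) :
    |(u + δ) ^ γ - u ^ γ| ≤ δ * u ^ (γ - 1) := by
  have hγ' := abs_le.mp hγ
  have key := (convex_Icc u (u + δ)).norm_image_sub_le_of_norm_hasDerivWithin_le
    (f := fun x : ℝ => x ^ γ) (f' := fun x => γ * x ^ (γ - 1)) (C := u ^ (γ - 1))
    (x := u) (y := u + δ)
    (fun x hx => (Real.hasDerivAt_rpow_const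
      (Or.inl (hu.trans_le hx.1).ne')).hasDerivWithinAt)
    (fun x hx => by
      have hx0 : 0 < x := hu.trans_le hx.1
      have h1 : x ^ (γ - 1) ≤ u ^ (γ - 1) :=
        Real.rpow_le_rpow_of_nonpos hu hx.1 (by linarith)
      have h2 : 0 < x ^ (γ - 1) := Real.rpow_pos_of_pos hx0 _
      rw [Real.norm_eq_abs, abs_mul, abs_of_pos h2]
      nlinarith)
    (Set.left_mem_Icc.mpr (by linarith)) (Set.right_mem_Icc.mpr (by linarith))
  simp only [Real.norm_eq_abs, add_sub_cancel_left, abs_of_nonneg hδ] at key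
  linarith

lemma sq_rpow_eq {x : ℝ} (hx : 0 ≤ x) (γ : ℝ) : (x ^ γ) ^ 2 = x ^ (2 * γ) := by
  rw [← Real.rpow_natCast, ← Real.rpow_mul hx]
  congr 1
  push_cast
  ring

/-- Bound for the squared increment away from the singularity. -/
lemma sq_rpow_add_sub_rpow_le_far {γ u δ h : ℝ} (hγ : |γ| ≤ 1) (hu : 0 < u)
    (hδ : 0 ≤ δ) (hδh : δ ≤ h) :
    |(u + δ) ^ γ - u ^ γ| ^ 2 ≤ h ^ 2 * u ^ (2 * γ - 2) := by
  have h1 := abs_rpow_add_sub_rpow_le hγ hu hδ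
  have h2 : 0 < u ^ (γ - 1) := Real.rpow_pos_of_pos hu _
  calc |(u + δ) ^ γ - u ^ γ| ^ 2 ≤ (h * u ^ (γ - 1)) ^ 2 := by
        gcongr
        exact h1.trans (by gcongr)
    _ = h ^ 2 * u ^ (2 * γ - 2) := by
        rw [mul_pow, sq_rpow_eq hu.le]
        ring_nf

/-- Bound for the squared increment near the singularity. -/
lemma sq_rpow_add_sub_rpow_le_near {γ u δ h : ℝ} (hγ : γ ≤ 1) (hu : 0 < u)
    (hδ : 0 ≤ δ) (hδh : δ ≤ h) :
    |(u + δ) ^ γ - u ^ γ| ^ 2 ≤ h ^ (2 * γ) + u ^ (2 * γ) := by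
  have hh : 0 ≤ h := hδ.trans hδh
  have p1 : 0 ≤ h ^ (2 * γ) := Real.rpow_nonneg hh _
  have p2 : 0 ≤ u ^ (2 * γ) := Real.rpow_nonneg hu.le _
  rcases le_or_gt 0 γ with h0 | h0
  · have h1 : (u + δ) ^ γ ≤ u ^ γ + δ ^ γ := Real.rpow_add_le_add_rpow hu.le hδ h0 hγ
    have h2 : u ^ γ ≤ (u + δ) ^ γ := Real.rpow_le_rpow hu.le (by linarith) h0
    have h3 : δ ^ γ ≤ h ^ γ := Real.rpow_le_rpow hδ hδh h0
    have h4 : |(u + δ) ^ γ - u ^ γ| ^ 2 ≤ (h ^ γ) ^ 2 := by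
      gcongr
      rw [abs_of_nonneg (by linarith)]
      linarith
    rw [sq_rpow_eq hh] at h4
    linarith
  · have h1 : 0 < (u + δ) ^ γ := Real.rpow_pos_of_pos (by linarith) _
    have h2 : (u + δ) ^ γ ≤ u ^ γ := Real.rpow_le_rpow_of_nonpos hu (by linarith) h0.le
    have h4 : |(u + δ) ^ γ - u ^ γ| ^ 2 ≤ (u ^ γ) ^ 2 := by
      gcongr
      rw [abs_of_nonpos (by linarith)]
      linarith
    rw [sq_rpow_eq hu.le] at h4
    linarith

/-- Domination on an interval gives integrability and comparison of integrals. -/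
lemma intervalIntegrable_and_integral_le_of_le {f g : ℝ → ℝ} {x y : ℝ} (hxy : x ≤ y)
    (hf : Measurable f) (hf0 : ∀ u, 0 ≤ f u) (hg : IntervalIntegrable g MeasureTheory.volume x y)
    (hfg : ∀ u ∈ Set.Ioc x y, f u ≤ g u) :
    IntervalIntegrable f MeasureTheory.volume x y ∧ (∫ u in x..y, f u) ≤ ∫ u in x..y, g u := by
  have hfi : IntervalIntegrable f MeasureTheory.volume x y := by
    rw [intervalIntegrable_iff_integrableOn_Ioc_of_le hxy] at hg ⊢
    refine MeasureTheory.Integrable.mono' hg hf.aestronglyMeasurable ?_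
    filter_upwards [MeasureTheory.ae_restrict_mem measurableSet_Ioc] with u hu
    rw [Real.norm_eq_abs, abs_of_nonneg (hf0 u)]
    exact hfg u hu
  exact ⟨hfi, intervalIntegral.integral_mono_on_of_le_Ioo hxy hfi hg
    fun u hu => hfg u (Set.Ioo_subset_Ioc_self hu)⟩

lemma measurable_sq_rpow_add_sub_rpow (γ δ : ℝ) :
    Measurable fun u : ℝ => |(u + δ) ^ γ - u ^ γ| ^ 2 := by
  have h : Measurable fun u : ℝ => (u + δ) ^ γ - u ^ γ :=
    ((measurable_id.add_const δ).pow_const γ).sub (measurable_id.pow_const γ)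
  simpa only [sq_abs] using h.pow_const 2

lemma integral_sq_increment_le_of_half_lt {γ δ h M : ℝ} (hγ : 1 / 2 < γ) (hγ1 : γ ≤ 1)
    (hδ : 0 ≤ δ) (hδh : δ ≤ h) (hM : 0 ≤ M) :
    (∫ u in (0 : ℝ)..M, |(u + δ) ^ γ - u ^ γ| ^ 2) ≤
      h ^ 2 * (M ^ (2 * γ - 1) / (2 * γ - 1)) := by
  have hab : |γ| ≤ 1 := abs_le.mpr ⟨by linarith, hγ1⟩
  refine (intervalIntegrable_and_integral_le_of_le hM (measurable_sq_rpow_add_sub_rpow γ δ)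
    (fun u => by positivity)
    ((intervalIntegral.intervalIntegrable_rpow' (by linarith : -1 < 2 * γ - 2)).const_mul (h ^ 2))
    fun u hu => sq_rpow_add_sub_rpow_le_far hab hu.1 hδ hδh).2.trans ?_
  rw [intervalIntegral.integral_const_mul, integral_rpow (Or.inl (by linarith)),
    show 2 * γ - 2 + 1 = 2 * γ - 1 by ring, Real.zero_rpow (by linarith), sub_zero]

lemma integral_sq_increment_le_near_add_far {γ δ h M : ℝ} (hγ : -(1 / 2) < γ) (hγ1 : γ ≤ 1)
    (hδ : 0 ≤ δ) (hδh : δ ≤ h) (h0 : 0 < h) (hM : h ≤ M) :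
    (∫ u in (0 : ℝ)..M, |(u + δ) ^ γ - u ^ γ| ^ 2) ≤
      h ^ (2 * γ + 1) * (1 + 1 / (2 * γ + 1)) + h ^ 2 * ∫ u in h..M, u ^ (2 * γ - 2) := by
  have hab : |γ| ≤ 1 := abs_le.mpr ⟨by linarith, hγ1⟩
  have hint : IntervalIntegrable (fun u : ℝ => u ^ (2 * γ)) MeasureTheory.volume 0 h :=
    intervalIntegral.intervalIntegrable_rpow' (by linarith)
  obtain ⟨i1, l1⟩ := intervalIntegrable_and_integral_le_of_le h0.le
    (measurable_sq_rpow_add_sub_rpow γ δ) (fun u => by positivity)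
    (intervalIntegrable_const.add hint)
    fun u hu => sq_rpow_add_sub_rpow_le_near hγ1 hu.1 hδ hδh
  have hzero : (0 : ℝ) ∉ Set.uIcc h M := by
    rw [Set.uIcc_of_le hM]
    exact fun hx => absurd hx.1 (not_le.mpr h0)
  obtain ⟨i2, l2⟩ := intervalIntegrable_and_integral_le_of_le hM
    (measurable_sq_rpow_add_sub_rpow γ δ) (fun u => by positivity)
    ((intervalIntegral.intervalIntegrable_rpow (r := 2 * γ - 2) (Or.inr hzero)).const_mul (h ^ 2))
    fun u hu => sq_rpow_add_sub_rpow_le_far hab (h0.trans hu.1) hδ hδh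
  rw [← intervalIntegral.integral_add_adjacent_intervals i1 i2]
  refine add_le_add (l1.trans_eq ?_) (l2.trans_eq ?_)
  · rw [intervalIntegral.integral_add intervalIntegrable_const hint,
      intervalIntegral.integral_const, integral_rpow (Or.inl (by linarith)),
      Real.zero_rpow (by linarith), smul_eq_mul, Real.rpow_add_one h0.ne']
    ring
  · rw [intervalIntegral.integral_const_mul]

lemma integral_sq_increment_le_of_eq_half {δ h M : ℝ}
    (hδ : 0 ≤ δ) (hδh : δ ≤ h) (h0 : 0 < h) (hM : h ≤ M) :
    (∫ u in (0 : ℝ)..M, |(u + δ) ^ (1 / 2 : ℝ) - u ^ (1 / 2 : ℝ)| ^ 2) ≤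
      h ^ 2 * (3 / 2 + Real.log (M / h)) := by
  refine (integral_sq_increment_le_near_add_far (by norm_num) (by norm_num)
    hδ hδh h0 hM).trans_eq ?_
  have e : (2 * (1 / 2) - 2 : ℝ) = -1 := by norm_num
  have e2 : (2 * (1 / 2) + 1 : ℝ) = (2 : ℕ) := by norm_num
  rw [e, e2, Real.rpow_natCast]
  simp only [Real.rpow_neg_one]
  rw [integral_inv_of_pos h0 (h0.trans_le hM)]
  push_cast
  ring

lemma integral_sq_increment_le_of_lt_half {γ δ h M : ℝ} (hγ : -(1 / 2) < γ) (hγ1 : γ < 1 / 2)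
    (hδ : 0 ≤ δ) (hδh : δ ≤ h) (h0 : 0 < h) (hM : h ≤ M) :
    (∫ u in (0 : ℝ)..M, |(u + δ) ^ γ - u ^ γ| ^ 2) ≤
      h ^ (2 * γ + 1) * (1 + 1 / (2 * γ + 1) + 1 / (1 - 2 * γ)) := by
  refine (integral_sq_increment_le_near_add_far hγ (by linarith) hδ hδh h0 hM).trans ?_
  have hzero : (0 : ℝ) ∉ Set.uIcc h M := by
    rw [Set.uIcc_of_le hM]
    exact fun hx => absurd hx.1 (not_le.mpr h0)
  have hp : 0 < 1 - 2 * γ := by linarith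
  have hle : (∫ u in h..M, u ^ (2 * γ - 2)) ≤ h ^ (2 * γ - 1) / (1 - 2 * γ) := by
    rw [integral_rpow (Or.inr ⟨by linarith, hzero⟩), show 2 * γ - 2 + 1 = 2 * γ - 1 by ring,
      ← neg_div_neg_eq, neg_sub, neg_sub]
    have : 0 ≤ M ^ (2 * γ - 1) := Real.rpow_nonneg (h0.le.trans hM) _
    gcongr
    linarith
  have hpow : h ^ 2 * h ^ (2 * γ - 1) = h ^ (2 * γ + 1) := by
    rw [← Real.rpow_natCast h 2, ← Real.rpow_add h0]
    congr 1
    push_cast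
    ring
  calc _ ≤ h ^ (2 * γ + 1) * (1 + 1 / (2 * γ + 1)) +
        h ^ 2 * (h ^ (2 * γ - 1) / (1 - 2 * γ)) := by gcongr
    _ = _ := by
      rw [← mul_div_assoc, hpow]
      ring

lemma integral_sq_sub_rpow_eq (γ t M : ℝ) :
    (∫ s in (0 : ℝ)..M, |(t - s) ^ γ - (M - s) ^ γ| ^ 2) =
      ∫ u in (0 : ℝ)..M, |(u + (t - M)) ^ γ - u ^ γ| ^ 2 := by
  have := intervalIntegral.integral_comp_sub_left (a := 0) (b := M)
    (fun u : ℝ => |(u + (t - M)) ^ γ - u ^ γ| ^ 2) M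
  simp only [sub_self, sub_zero, sub_add_sub_cancel'] at this
  rw [← this]

/-- Lemma 3.2 of the paper. -/
theorem stmt_3 (T : ℝ) (hT : 0 < T) (a b : ℝ)
    (ha : a ∈ Set.Ioc (0:ℝ) 1) (hb : b ∈ Set.Ioo (0:ℝ) (1/2)) :
    ∃ C : ℝ, 0 < C ∧ ∀ N : ℕ, 1 ≤ N → ∀ n : ℕ, n ≤ N → ∀ t : ℝ,
      t ∈ Set.Ico ((n : ℝ) * (T / N)) (((n : ℝ) + 1) * (T / N)) →
      ((a - b ∈ Set.Ioo (1/2 : ℝ) 1 →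
          (∫ s in (0:ℝ)..((n : ℝ) * (T / N)),
              |(t - s) ^ (a - b) - ((n : ℝ) * (T / N) - s) ^ (a - b)| ^ 2) ≤
            C * (N : ℝ) ^ (-2 : ℝ)) ∧
       (a - b = 1/2 → 2 ≤ N →
          (∫ s in (0:ℝ)..((n : ℝ) * (T / N)),
              |(t - s) ^ (a - b) - ((n : ℝ) * (T / N) - s) ^ (a - b)| ^ 2) ≤
            C * Real.log N * (N : ℝ) ^ (-2 : ℝ)) ∧
       (a - b ∈ Set.Ioo (-(1/2) : ℝ) (1/2) →
          (∫ s in (0:ℝ)..((n : ℝ) * (T / N)),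
              |(t - s) ^ (a - b) - ((n : ℝ) * (T / N) - s) ^ (a - b)| ^ 2) ≤
            C * (N : ℝ) ^ (-1 - 2 * (a - b)))) := by
  obtain ⟨ha0, ha1⟩ := ha
  obtain ⟨hb0, hb1⟩ := hb
  have hlow : -(1 / 2) < a - b := by linarith
  have hup : a - b < 1 := by linarith
  generalize a - b = γ at hlow hup ⊢
  have step : ∀ N : ℕ, 1 ≤ N → ∀ n : ℕ, n ≤ N → ∀ t : ℝ,
      t ∈ Set.Ico ((n : ℝ) * (T / N)) (((n : ℝ) + 1) * (T / N)) →
      0 < T / N ∧ 0 ≤ t - n * (T / N) ∧ t - n * (T / N) ≤ T / N ∧ n * (T / N) ≤ T := by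
    intro N hN n hn t ht
    have hN0 : (0 : ℝ) < N := by exact_mod_cast hN
    have hnN : (n : ℝ) ≤ N := by exact_mod_cast hn
    refine ⟨by positivity, by linarith [ht.1], by linarith [ht.2], ?_⟩
    calc (n : ℝ) * (T / N) ≤ N * (T / N) := by gcongr
      _ = T := by field_simp
  have hsq : ∀ N : ℕ, (T / N) ^ 2 = T ^ 2 * (N : ℝ) ^ (-2 : ℝ) := by
    intro N
    rw [Real.rpow_neg (Nat.cast_nonneg N), Real.rpow_two, div_pow, div_eq_mul_inv]
  simp only [integral_sq_sub_rpow_eq]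
  rcases lt_trichotomy γ (1 / 2) with hγ | rfl | hγ
  · have q1 : 0 < 2 * γ + 1 := by linarith
    have q2 : 0 < 1 - 2 * γ := by linarith
    refine ⟨T ^ (2 * γ + 1) * (1 + 1 / (2 * γ + 1) + 1 / (1 - 2 * γ)), by positivity,
      fun N hN n hn t ht => ⟨fun h => by linarith [h.1], fun h => by linarith, fun _ => ?_⟩⟩
    obtain ⟨h0, hδ, hδh, -⟩ := step N hN n hn t ht
    rcases Nat.eq_zero_or_pos n with rfl | hnpos
    · simp only [Nat.cast_zero, zero_mul, intervalIntegral.integral_same]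
      positivity
    have hn1 : (1 : ℝ) ≤ n := by exact_mod_cast hnpos
    refine (integral_sq_increment_le_of_lt_half hlow hγ hδ hδh h0
      (le_mul_of_one_le_left h0.le hn1)).trans_eq ?_
    rw [Real.div_rpow hT.le (Nat.cast_nonneg N), div_eq_mul_inv,
      ← Real.rpow_neg (Nat.cast_nonneg N), show -(2 * γ + 1) = -1 - 2 * γ by ring]
    ring
  · have hl2 : 0 < Real.log 2 := Real.log_pos (by norm_num)
    refine ⟨T ^ 2 * (3 / 2 / Real.log 2 + 1), by positivity,
      fun N hN n hn t ht => ⟨fun h => by linarith [h.1], fun _ hN2 => ?_, fun h => by linarith [h.2]⟩⟩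
    obtain ⟨h0, hδ, hδh, -⟩ := step N hN n hn t ht
    have hlog : Real.log 2 ≤ Real.log N :=
      Real.log_le_log (by norm_num) (by exact_mod_cast hN2)
    rcases Nat.eq_zero_or_pos n with rfl | hnpos
    · simp only [Nat.cast_zero, zero_mul, intervalIntegral.integral_same]
      have := hl2.trans_le hlog
      positivity
    have hn1 : (1 : ℝ) ≤ n := by exact_mod_cast hnpos
    refine (integral_sq_increment_le_of_eq_half hδ hδh h0
      (le_mul_of_one_le_left h0.le hn1)).trans ?_
    rw [mul_div_cancel_right₀ _ h0.ne', hsq]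
    have h1 : Real.log n ≤ Real.log N :=
      Real.log_le_log (by linarith) (by exact_mod_cast hn)
    have h2 : (3 / 2 : ℝ) ≤ 3 / 2 / Real.log 2 * Real.log N := by
      rw [div_mul_eq_mul_div, le_div_iff₀ hl2]
      linarith
    calc T ^ 2 * (N : ℝ) ^ (-2 : ℝ) * (3 / 2 + Real.log n)
        ≤ T ^ 2 * (N : ℝ) ^ (-2 : ℝ) * (3 / 2 / Real.log 2 * Real.log N + Real.log N) := by
          gcongr
      _ = _ := by ring
  · have q : 0 < 2 * γ - 1 := by linarith
    refine ⟨T ^ 2 * (T ^ (2 * γ - 1) / (2 * γ - 1)), by positivity,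
      fun N hN n hn t ht => ⟨fun _ => ?_, fun h => by linarith, fun h => by linarith [h.2]⟩⟩
    obtain ⟨h0, hδ, hδh, hMT⟩ := step N hN n hn t ht
    have hM : 0 ≤ (n : ℝ) * (T / N) := by positivity
    refine (integral_sq_increment_le_of_half_lt hγ hup.le hδ hδh hM).trans ?_
    rw [hsq]
    calc T ^ 2 * (N : ℝ) ^ (-2 : ℝ) * (((n : ℝ) * (T / N)) ^ (2 * γ - 1) / (2 * γ - 1))
        ≤ T ^ 2 * (N : ℝ) ^ (-2 : ℝ) * (T ^ (2 * γ - 1) / (2 * γ - 1)) := by gcongr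
      _ = _ := by ring
end

section
/- Let T > 0 and let c ∈ (1/2, 1). Then for every integer N ≥ 1, every n ∈ {1,...,N}, and every t ∈ [t_n, t_{n+1}), one has ∫₀^{t_n} |(t−s)^{c} − (t_n−s)^{c}|² ds ≤ c² · (T/N)² · t_n^{2c−1}/(2c−1), and in particular ∫₀^{t_n} |(t−s)^{c} − (t_n−s)^{c}|² ds ≤ (c² T^{2c+1}/(2c−1)) · N^{−2}. -/
/-- Concavity bound for increments of `x ↦ x ^ c` with `0 ≤ c ≤ 1`. -/
theorem sq_abs_rpow_sub_rpow_le {c x y : ℝ} (hc₀ : 0 ≤ c) (hc₁ : c ≤ 1) (hx : 0 < x)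
    (hxy : x ≤ y) :
    |y ^ c - x ^ c| ^ 2 ≤ c ^ 2 * (y - x) ^ 2 * x ^ (2 * c - 2) := by
  have hnonneg : 0 ≤ y ^ c - x ^ c := sub_nonneg.2 (Real.rpow_le_rpow hx.le hxy hc₀)
  have hfrac : 0 ≤ (y - x) / x := div_nonneg (sub_nonneg.2 hxy) hx.le
  have bernoulli : (1 + (y - x) / x) ^ c ≤ 1 + c * ((y - x) / x) :=
    rpow_one_add_le_one_add_mul_self (by linarith) hc₀ hc₁
  have hy : y ^ c = x ^ c * (1 + (y - x) / x) ^ c := by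
    rw [← Real.mul_rpow hx.le (by linarith)]
    congr 1
    field_simp
    ring
  have hle : y ^ c - x ^ c ≤ c * (y - x) * x ^ (c - 1) := by
    calc y ^ c - x ^ c ≤ x ^ c * (1 + c * ((y - x) / x)) - x ^ c := by
          rw [hy]
          gcongr
      _ = c * (y - x) * x ^ (c - 1) := by
          rw [Real.rpow_sub_one hx.ne']
          ring
  calc |y ^ c - x ^ c| ^ 2 ≤ (c * (y - x) * x ^ (c - 1)) ^ 2 := by
        rw [sq_abs]
        gcongr
    _ = c ^ 2 * (y - x) ^ 2 * x ^ (2 * c - 2) := by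
        rw [mul_pow, mul_pow, ← Real.rpow_mul_natCast hx.le]
        congr 2
        push_cast
        ring

/-- Mean-square bound for the shift of the kernel `s ↦ (u - s) ^ c` on `[0, u]`. -/
theorem integral_sq_abs_rpow_sub_rpow_le {c t u : ℝ} (hc : 1 / 2 < c) (hc₁ : c ≤ 1)
    (hu : 0 ≤ u) (hut : u ≤ t) :
    ∫ s in (0 : ℝ)..u, |(t - s) ^ c - (u - s) ^ c| ^ 2 ≤
      c ^ 2 * (t - u) ^ 2 * u ^ (2 * c - 1) / (2 * c - 1) := by
  have hc₀ : 0 ≤ c := by linarith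
  have hcont : Continuous fun s : ℝ ↦ |(t - s) ^ c - (u - s) ^ c| ^ 2 :=
    ((((continuous_const.sub continuous_id).rpow_const fun _ ↦ Or.inr hc₀).sub
      ((continuous_const.sub continuous_id).rpow_const fun _ ↦ Or.inr hc₀)).abs).pow 2
  have hint : IntervalIntegrable (fun s : ℝ ↦ (u - s) ^ (2 * c - 2)) MeasureTheory.volume 0 u := by
    simpa using ((intervalIntegral.intervalIntegrable_rpow' (a := 0) (b := u)
      (show -1 < 2 * c - 2 by linarith)).comp_sub_left u).symm
  calc ∫ s in (0 : ℝ)..u, |(t - s) ^ c - (u - s) ^ c| ^ 2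
      ≤ ∫ s in (0 : ℝ)..u, c ^ 2 * (t - u) ^ 2 * (u - s) ^ (2 * c - 2) := by
        refine intervalIntegral.integral_mono_on_of_le_Ioo hu (hcont.intervalIntegrable _ _)
          (hint.const_mul _) fun s hs ↦ ?_
        have h := sq_abs_rpow_sub_rpow_le hc₀ hc₁ (sub_pos.2 hs.2) (sub_le_sub_right hut s)
        rwa [sub_sub_sub_cancel_right] at h
    _ = c ^ 2 * (t - u) ^ 2 * u ^ (2 * c - 1) / (2 * c - 1) := by
        rw [intervalIntegral.integral_const_mul,
          intervalIntegral.integral_comp_sub_left (fun x ↦ x ^ (2 * c - 2)) u,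
          integral_rpow (Or.inl (by linarith)), sub_self, sub_zero,
          show 2 * c - 2 + 1 = 2 * c - 1 by ring, Real.zero_rpow (by linarith)]
        ring


/-- The explicit bound in the proof of Lemma 3.2, case `c = a - b ∈ (1/2, 1)`. -/
theorem stmt_4 (T : ℝ) (hT : 0 < T) (c : ℝ) (hc : c ∈ Set.Ioo (1/2 : ℝ) 1) :
    ∀ N : ℕ, 1 ≤ N → ∀ n : ℕ, 1 ≤ n → n ≤ N → ∀ t : ℝ,
      t ∈ Set.Ico ((n : ℝ) * (T / N)) (((n : ℝ) + 1) * (T / N)) →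
      (∫ s in (0:ℝ)..((n : ℝ) * (T / N)),
          |(t - s) ^ c - ((n : ℝ) * (T / N) - s) ^ c| ^ 2) ≤
        c ^ 2 * (T / N) ^ 2 * ((n : ℝ) * (T / N)) ^ (2 * c - 1) / (2 * c - 1) ∧
      (∫ s in (0:ℝ)..((n : ℝ) * (T / N)),
          |(t - s) ^ c - ((n : ℝ) * (T / N) - s) ^ c| ^ 2) ≤
        (c ^ 2 * T ^ (2 * c + 1) / (2 * c - 1)) * (N : ℝ) ^ (-2 : ℝ) := by
  intro N hN n _ hnN t ht
  have hc' : 0 < 2 * c - 1 := by linarith [hc.1]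
  have hN' : (0 : ℝ) < N := by exact_mod_cast hN
  have hnN' : (n : ℝ) ≤ N := by exact_mod_cast hnN
  have hu : 0 ≤ (n : ℝ) * (T / N) := by positivity
  have huT : (n : ℝ) * (T / N) ≤ T := by
    calc (n : ℝ) * (T / N) ≤ N * (T / N) := by gcongr
      _ = T := by field_simp
  have hstep : t - n * (T / N) ≤ T / N := by linarith [ht.2]
  have hstep₀ : 0 ≤ t - n * (T / N) := sub_nonneg.2 ht.1
  have hbound : (∫ s in (0:ℝ)..((n : ℝ) * (T / N)),
      |(t - s) ^ c - ((n : ℝ) * (T / N) - s) ^ c| ^ 2) ≤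
      c ^ 2 * (T / N) ^ 2 * ((n : ℝ) * (T / N)) ^ (2 * c - 1) / (2 * c - 1) :=
    (integral_sq_abs_rpow_sub_rpow_le hc.1 hc.2.le hu ht.1).trans (by gcongr)
  refine ⟨hbound, hbound.trans ?_⟩
  calc c ^ 2 * (T / N) ^ 2 * ((n : ℝ) * (T / N)) ^ (2 * c - 1) / (2 * c - 1)
      ≤ c ^ 2 * (T / N) ^ 2 * T ^ (2 * c - 1) / (2 * c - 1) := by gcongr
    _ = (c ^ 2 * T ^ (2 * c + 1) / (2 * c - 1)) * (N : ℝ) ^ (-2 : ℝ) := by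
        rw [show 2 * c + 1 = 2 * c - 1 + (2 : ℕ) by push_cast; ring,
          Real.rpow_add_natCast hT.ne', Real.rpow_neg hN'.le, Real.rpow_two]
        ring
end

section
/- Let T > 0. Then for every integer N ≥ 1, every n ∈ {1,...,N}, and every t ∈ [t_n, t_{n+1}), one has ∫₀^{t_n} |(t−s)^{1/2} − (t_n−s)^{1/2}|² ds ≤ (T/N)² · Σ_{j=1}^{n} (√(j+1) − √(j−1))². -/
/-- Replacing `s` by its value at the worst endpoint of a grid cell of width `h`. -/
lemma sq_abs_sub_sqrt_le_of_mem_cell {h t s m k : ℝ} (hh : 0 ≤ h) (hkm : k + 1 ≤ m)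
    (ht : m * h ≤ t) (ht' : t ≤ (m + 1) * h) (hs : k * h ≤ s) (hs' : s ≤ (k + 1) * h) :
    |√(t - s) - √(m * h - s)| ^ 2 ≤ h * (√(m - k + 1) - √(m - k - 1)) ^ 2 := by
  have upper : √(t - s) ≤ √(m - k + 1) * √h := by
    rw [← Real.sqrt_mul (by linarith)]
    exact Real.sqrt_le_sqrt (by linarith)
  have lower : √(m - k - 1) * √h ≤ √(m * h - s) := by
    rw [← Real.sqrt_mul (by linarith)]
    exact Real.sqrt_le_sqrt (by linarith)
  have mono : √(m * h - s) ≤ √(t - s) := Real.sqrt_le_sqrt (by linarith)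
  calc |√(t - s) - √(m * h - s)| ^ 2
      ≤ (√(m - k + 1) * √h - √(m - k - 1) * √h) ^ 2 := by
        rw [abs_of_nonneg (by linarith)]
        exact pow_le_pow_left₀ (by linarith) (by linarith) 2
    _ = √h ^ 2 * (√(m - k + 1) - √(m - k - 1)) ^ 2 := by ring
    _ = h * (√(m - k + 1) - √(m - k - 1)) ^ 2 := by rw [Real.sq_sqrt hh]

/-- Summing the cellwise bounds over a uniform grid with `n` cells of width `h`. -/
lemma integral_sq_abs_sub_sqrt_le {h t : ℝ} {n : ℕ} (hh : 0 ≤ h)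
    (ht : n * h ≤ t) (ht' : t ≤ (n + 1) * h) :
    ∫ s in (0 : ℝ)..(n * h), |√(t - s) - √(n * h - s)| ^ 2 ≤
      h ^ 2 * ∑ j ∈ Finset.Icc 1 n, (√((j : ℝ) + 1) - √((j : ℝ) - 1)) ^ 2 := by
  set f : ℝ → ℝ := fun s => |√(t - s) - √(n * h - s)| ^ 2 with hf
  have integrable (a b : ℝ) : IntervalIntegrable f MeasureTheory.volume a b :=
    (by fun_prop : Continuous f).intervalIntegrable a b
  have split := intervalIntegral.sum_integral_adjacent_intervals (f := f)
    (μ := MeasureTheory.volume) (a := fun k : ℕ => (k : ℝ) * h) (n := n)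
    fun k _ => integrable _ _
  simp only [Nat.cast_zero, zero_mul] at split
  have reflect : ∑ j ∈ Finset.Icc 1 n, (√((j : ℝ) + 1) - √((j : ℝ) - 1)) ^ 2 =
      ∑ k ∈ Finset.range n, (√((n : ℝ) - k + 1) - √((n : ℝ) - k - 1)) ^ 2 := by
    refine Finset.sum_nbij' (fun j => n - j) (fun k => n - k) ?_ ?_ ?_ ?_ ?_
    · intro j hj; simp only [Finset.mem_Icc, Finset.mem_range] at *; omega
    · intro k hk; simp only [Finset.mem_Icc, Finset.mem_range] at *; omega
    · intro j hj; simp only [Finset.mem_Icc] at hj; omega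
    · intro k hk; simp only [Finset.mem_range] at hk; omega
    · intro j hj
      rw [Nat.cast_sub (Finset.mem_Icc.mp hj).2, sub_sub_cancel]
  rw [← split, reflect, Finset.mul_sum]
  refine Finset.sum_le_sum fun k hk => ?_
  have hkn : (k : ℝ) + 1 ≤ n := by exact_mod_cast Finset.mem_range.mp hk
  push_cast
  calc ∫ s in (k * h)..((k + 1) * h), f s
      ≤ ∫ _ in (k * h)..((k + 1) * h), h * (√((n : ℝ) - k + 1) - √((n : ℝ) - k - 1)) ^ 2 :=
        intervalIntegral.integral_mono_on (by linarith) (integrable _ _) (by simp)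
          fun s hs => sq_abs_sub_sqrt_le_of_mem_cell hh hkn ht ht' hs.1 hs.2
    _ = h ^ 2 * (√((n : ℝ) - k + 1) - √((n : ℝ) - k - 1)) ^ 2 := by
        rw [intervalIntegral.integral_const, smul_eq_mul]
        ring

/-- The explicit sum bound in the proof of Lemma 3.2, case `a - b = 1/2`. -/
theorem stmt_5 (T : ℝ) (hT : 0 < T) :
    ∀ N : ℕ, 1 ≤ N → ∀ n : ℕ, 1 ≤ n → n ≤ N → ∀ t : ℝ,
      t ∈ Set.Ico ((n : ℝ) * (T / N)) (((n : ℝ) + 1) * (T / N)) →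
      (∫ s in (0:ℝ)..((n : ℝ) * (T / N)),
          |(t - s) ^ (1/2 : ℝ) - ((n : ℝ) * (T / N) - s) ^ (1/2 : ℝ)| ^ 2) ≤
        (T / N) ^ 2 *
          ∑ j ∈ Finset.Icc 1 n, (Real.sqrt ((j : ℝ) + 1) - Real.sqrt ((j : ℝ) - 1)) ^ 2 := by
  intro N _ n _ _ t ht
  simp only [← Real.sqrt_eq_rpow]
  exact integral_sq_abs_sub_sqrt_le (by positivity) ht.1 ht.2.le
end

section
/- Let T > 0 and a, b ∈ (0,1]. For an integer N ≥ 1 and s ∈ [0,T), let ⌊s⌋_h denote t_n = n·h for the unique n with s ∈ [t_n, t_{n+1}), where h = T/N. Then there exists a constant C > 0, independent of h (equivalently of N), such that for every integer N ≥ 1 and every t ∈ [0,T], one has ∫₀^{t} |(t − ⌊s⌋_h)^{a−b} − (t − s)^{a−b}| ds ≤ C · h^{min(1, 1+a−b)}. -/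
open MeasureTheory Set in
/-- The integral of a forward difference of a power function, with the domains of integration
shifted so that only the two end intervals of length `h` remain. -/
theorem integral_rpow_add_sub_rpow {c : ℝ} (hc : -1 < c) (t h : ℝ) :
    (∫ u in (0:ℝ)..t, ((u + h) ^ c - u ^ c)) =
      (∫ u in t..(t + h), u ^ c) - ∫ u in (0:ℝ)..h, u ^ c := by
  have hi : ∀ x y : ℝ, IntervalIntegrable (fun u : ℝ => u ^ c) volume x y :=
    fun x y => intervalIntegral.intervalIntegrable_rpow' hc
  have hshift : IntervalIntegrable (fun u : ℝ => (u + h) ^ c) volume 0 t := by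
    simpa using (hi (0 + h) (t + h)).comp_add_right h
  rw [intervalIntegral.integral_sub hshift (hi 0 t),
    intervalIntegral.integral_comp_add_right (fun u : ℝ => u ^ c), zero_add]
  have h1 := intervalIntegral.integral_add_adjacent_intervals (hi 0 h) (hi h (t + h))
  have h2 := intervalIntegral.integral_add_adjacent_intervals (hi 0 t) (hi t (t + h))
  linarith

open MeasureTheory Set in
/-- Replacing `s` by a point `r s` within distance `h` to the left of `s` changes the kernel
`(t - s) ^ c` by at most the forward difference with step `h`, in integrated form. -/
theorem integral_abs_rpow_sub_le {c k t h : ℝ} (hc : -1 < c) (ht : 0 ≤ t) {r : ℝ → ℝ}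
    (hr : ∀ s, r s ≤ s) (hr' : ∀ s, s ≤ r s + h)
    (hk : ∀ u v : ℝ, 0 < u → u ≤ v → v ≤ u + h →
      |v ^ c - u ^ c| ≤ k * ((u + h) ^ c - u ^ c)) :
    (∫ s in (0:ℝ)..t, |(t - r s) ^ c - (t - s) ^ c|) ≤
      k * ((∫ u in t..(t + h), u ^ c) - ∫ u in (0:ℝ)..h, u ^ c) := by
  have hi : ∀ x y : ℝ, IntervalIntegrable (fun u : ℝ => u ^ c) volume x y :=
    fun x y => intervalIntegral.intervalIntegrable_rpow' hc
  have hg : IntervalIntegrable (fun u : ℝ => k * ((u + h) ^ c - u ^ c)) volume 0 t := by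
    refine (IntervalIntegrable.sub ?_ (hi 0 t)).const_mul k
    simpa using (hi (0 + h) (t + h)).comp_add_right h
  have hg' : IntervalIntegrable (fun s : ℝ => k * ((t - s + h) ^ c - (t - s) ^ c))
      volume 0 t := by
    simpa using (hg.comp_sub_left t).symm
  rw [← integral_rpow_add_sub_rpow hc, ← intervalIntegral.integral_const_mul]
  have hrefl := intervalIntegral.integral_comp_sub_left (a := 0) (b := t)
    (fun u : ℝ => k * ((u + h) ^ c - u ^ c)) t
  rw [sub_self, sub_zero] at hrefl
  rw [← hrefl, intervalIntegral.integral_of_le ht, intervalIntegral.integral_of_le ht,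
    integral_Ioc_eq_integral_Ioo, integral_Ioc_eq_integral_Ioo]
  refine integral_mono_of_nonneg (ae_of_all _ fun s => abs_nonneg _) ?_ ?_
  · exact ((intervalIntegrable_iff_integrableOn_Ioc_of_le ht).1 hg').mono_set Ioo_subset_Ioc_self
  · filter_upwards [ae_restrict_mem measurableSet_Ioo] with s hs
    exact hk _ _ (sub_pos.2 hs.2) (by linarith [hr s]) (by linarith [hr' s])

/-- The second inequality of Lemma 4.1 of the paper, where `⌊s⌋_h = ⌊s/h⌋ * h` with
`h = T/N` is the left mesh point of the subinterval containing `s`. -/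
theorem stmt_8 (T : ℝ) (hT : 0 < T) (a b : ℝ)
    (ha : a ∈ Set.Ioc (0:ℝ) 1) (hb : b ∈ Set.Ioc (0:ℝ) 1) :
    ∃ C : ℝ, 0 < C ∧ ∀ N : ℕ, 1 ≤ N → ∀ t : ℝ, t ∈ Set.Icc (0:ℝ) T →
      (∫ s in (0:ℝ)..t,
          |(t - (⌊s / (T / N)⌋ : ℝ) * (T / N)) ^ (a - b) - (t - s) ^ (a - b)|) ≤
        C * (T / N) ^ (min (1:ℝ) (1 + a - b)) := by
  have hc : -1 < a - b := by linarith [ha.1, hb.2]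
  rw [add_sub_assoc]
  generalize a - b = c at hc
  have hfloor : ∀ {h : ℝ}, 0 < h → ∀ s : ℝ, (⌊s / h⌋ : ℝ) * h ≤ s := fun hh s =>
    (le_div_iff₀ hh).1 (Int.floor_le _)
  have hfloor' : ∀ {h : ℝ}, 0 < h → ∀ s : ℝ, s ≤ (⌊s / h⌋ : ℝ) * h + h := fun {h} hh s => by
    have := (div_le_iff₀ hh).1 (Int.lt_floor_add_one (s / h)).le
    linarith
  have hstep : ∀ {N : ℕ}, 1 ≤ N → 0 < T / N := fun hN =>
    div_pos hT (by exact_mod_cast hN)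
  rcases le_or_gt 0 c with h0 | h0
  · refine ⟨(2 * T) ^ c, by positivity, fun N hN t ht => ?_⟩
    have hh := hstep hN
    have hhT : T / N ≤ T := div_le_self hT.le (by exact_mod_cast hN)
    generalize T / (N : ℝ) = h at hh hhT
    rw [min_eq_left (by linarith), Real.rpow_one]
    refine (integral_abs_rpow_sub_le (k := 1) hc ht.1 (hfloor hh) (hfloor' hh)
      fun u v hu huv hvu => ?_).trans ?_
    · have h1 := Real.rpow_le_rpow hu.le huv h0
      have h2 := Real.rpow_le_rpow (hu.le.trans huv) hvu h0
      rw [abs_of_nonneg (by linarith)]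
      linarith
    · have h1 : 0 ≤ ∫ u in (0:ℝ)..h, u ^ c :=
        intervalIntegral.integral_nonneg hh.le fun u hu => Real.rpow_nonneg hu.1 c
      have h2 : (∫ u in t..(t + h), u ^ c) ≤ ∫ _u in t..(t + h), (2 * T) ^ c :=
        intervalIntegral.integral_mono_on (by linarith)
          (intervalIntegral.intervalIntegrable_rpow' hc) intervalIntegrable_const
          fun u hu => Real.rpow_le_rpow (ht.1.trans hu.1) (by linarith [hu.2, ht.2]) h0
      rw [intervalIntegral.integral_const, smul_eq_mul] at h2
      linarith
  · refine ⟨1 / (1 + c), one_div_pos.2 (by linarith), fun N hN t ht => ?_⟩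
    have hh := hstep hN
    generalize T / (N : ℝ) = h at hh
    rw [min_eq_right (by linarith)]
    refine (integral_abs_rpow_sub_le (k := -1) hc ht.1 (hfloor hh) (hfloor' hh)
      fun u v hu huv hvu => ?_).trans ?_
    · have h1 := Real.rpow_le_rpow_of_nonpos hu huv h0.le
      have h2 := Real.rpow_le_rpow_of_nonpos (hu.trans_le huv) hvu h0.le
      rw [abs_of_nonpos (by linarith)]
      linarith
    · have h1 : 0 ≤ ∫ u in t..(t + h), u ^ c :=
        intervalIntegral.integral_nonneg (by linarith)
          fun u hu => Real.rpow_nonneg (ht.1.trans hu.1) c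
      have h2 : (∫ u in (0:ℝ)..h, u ^ c) = 1 / (1 + c) * h ^ (1 + c) := by
        rw [integral_rpow (Or.inl hc), Real.zero_rpow (by linarith), add_comm c 1]
        ring
      linarith
end
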